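/- Let X be a real Hilbert space, c : X × X → ℝ a continuous symmetric bilinear form, and S a closed subspace of X on which c satisfies the inf-sup condition with constant γ > 0 (i.e., for every s ∈ S, γ‖s‖ ≤ sup {c(s, t) : t ∈ S, ‖t‖ ≤ 1}). Then for every x ∈ X there exists s ∈ S such that c(x − s, t) = 0 for all t ∈ S; equivalently, A + S = X, where A = {x ∈ X : c(x, t) = 0 for all t ∈ S} is the c-orthogonal complement of S. -/

import Mathlib

/-- The inf-sup condition for a bilinear form `c` on a subspace `S` (given as a set)
with constant `γ`: for every `u ∈ S`, `γ‖u‖ ≤ sup {c(u,v) : v ∈ S, ‖v‖ ≤ 1}`. -/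
def InfSupOn {X : Type*} [NormedAddCommGroup X] [InnerProductSpace ℝ X]
    (c : X →L[ℝ] X →L[ℝ] ℝ) (S : Set X) (γ : ℝ) : Prop :=
  ∀ u ∈ S, γ * ‖u‖ ≤ sSup ((fun v => c u v) '' {v | v ∈ S ∧ ‖v‖ ≤ 1})

open InnerProductSpace in
/-- A symmetric bilinear form on a real Hilbert space that is bounded below, as a map to the dual,
represents every continuous linear functional. -/
theorem ContinuousLinearMap.surjective_of_symm_of_bounded_below
    {V : Type*} [NormedAddCommGroup V] [InnerProductSpace ℝ V] [CompleteSpace V]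
    (b : V →L[ℝ] V →L[ℝ] ℝ) (hsymm : ∀ u v, b u v = b v u)
    {γ : ℝ} (hγ : 0 < γ) (hb : ∀ u, γ * ‖u‖ ≤ ‖b u‖) :
    Function.Surjective b := by
  let T : V →L[ℝ] V := continuousLinearMapOfBilin (𝕜 := ℝ) b
  have hTb : ∀ u v, inner ℝ (T u) v = b u v := continuousLinearMapOfBilin_apply b
  have hbT : ∀ u, ‖b u‖ ≤ ‖T u‖ := fun u =>
    (b u).opNorm_le_bound (norm_nonneg _) fun v => by
      rw [← hTb]
      exact norm_inner_le_norm _ _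
  have hanti : AntilipschitzWith (γ⁻¹).toNNReal T :=
    T.antilipschitz_of_bound fun u => by
      rw [Real.coe_toNNReal _ (inv_nonneg.2 hγ.le), inv_mul_eq_div, le_div_iff₀' hγ]
      exact (hb u).trans (hbT u)
  have hclosed : IsClosed (T.range : Set V) := hanti.isClosed_range T.uniformContinuous
  have := hclosed.completeSpace_coe
  have htop : T.range = ⊤ := by
    rw [← Submodule.orthogonal_eq_bot_iff, Submodule.eq_bot_iff]
    intro w hw
    refine hanti.injective ?_
    rw [map_zero, ← inner_self_eq_zero (𝕜 := ℝ), hTb, hsymm, ← hTb]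
    exact hw _ ⟨_, rfl⟩
  intro f
  obtain ⟨u, hu⟩ : (toDual ℝ V).symm f ∈ T.range := htop ▸ Submodule.mem_top
  refine ⟨u, ContinuousLinearMap.ext fun v => ?_⟩
  rw [← hTb]
  exact (congrArg (inner ℝ · v) hu).trans toDual_symm_apply

/-- The inf-sup condition bounds from below the norm of the functionals restricted to `S`. -/
theorem InfSupOn.le_norm_comp_subtypeL {X : Type*} [NormedAddCommGroup X] [InnerProductSpace ℝ X]
    {c : X →L[ℝ] X →L[ℝ] ℝ} {S : Submodule ℝ X} {γ : ℝ} (h : InfSupOn c (S : Set X) γ) (u : S) :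
    γ * ‖u‖ ≤ ‖(c u).comp S.subtypeL‖ := by
  refine (h u u.2).trans (csSup_le ⟨_, 0, ⟨S.zero_mem, by simp⟩, rfl⟩ ?_)
  rintro _ ⟨v, ⟨hv, hv1⟩, rfl⟩
  exact (le_abs_self _).trans
    (((c u).comp S.subtypeL).unit_le_opNorm ⟨v, hv⟩ hv1)

/-- Let `X` be a real Hilbert space, `c` a continuous symmetric
bilinear form, and `S` a closed subspace of `X` on which `c` satisfies the
inf-sup condition with constant `γ > 0`. Then for every `x ∈ X` there exists
`s ∈ S` with `c(x - s, t) = 0` for all `t ∈ S` (i.e. `A + S = X` for the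
`c`-orthogonal complement `A` of `S`). -/
theorem c_orthogonal_projection_exists
    {X : Type*} [NormedAddCommGroup X] [InnerProductSpace ℝ X] [CompleteSpace X]
    (c : X →L[ℝ] X →L[ℝ] ℝ)
    (hsymm : ∀ u v : X, c u v = c v u)
    (S : Submodule ℝ X) (hSclosed : IsClosed (S : Set X))
    (γ : ℝ) (hγ : 0 < γ)
    (hinfsup : InfSupOn c (S : Set X) γ) :
    ∀ x : X, ∃ s ∈ S, ∀ t ∈ S, c (x - s) t = 0 := by
  intro x
  have := hSclosed.completeSpace_coe
  obtain ⟨s, hs⟩ := ContinuousLinearMap.surjective_of_symm_of_bounded_below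
    (c.bilinearComp S.subtypeL S.subtypeL) (fun u v => hsymm u v) hγ
    hinfsup.le_norm_comp_subtypeL ((c x).comp S.subtypeL)
  refine ⟨s, s.2, fun t ht => ?_⟩
  have hst : c s t = c x t := DFunLike.congr_fun hs ⟨t, ht⟩
  rw [map_sub, sub_apply, hst, sub_self]
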